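/- Exactness of the random-permutation test under the partition condition: suppose G admits a partition {G₁,…,G_m} of equal-size blocks with id ∈ G₁ such that a.s. T(gX) = T(g'X) iff g,g' are in the same block, with distinct values across blocks. Pick representatives h₁ ∈ G₁, …, h_m ∈ G_m, set g₁ = id, and draw g₂, …, g_w uniformly without replacement from {h₂, …, h_m}, independent of X. Then the test rejecting when T(X) > T^(k')(X,G'), with k' = ⌈(1−α)w⌉, has rejection probability exactly α for every α ∈ {0/w, 1/w, …, (w−1)/w}. -/

import Mathlib

open MeasureTheory Finset

/-- The `k`-th smallest element (1-based) of a multiset of reals. -/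
noncomputable def sortedVal (s : Multiset ℝ) (k : ℕ) : ℝ :=
  (s.sort (· ≤ ·)).getD (k - 1) 0


lemma aux_sorted (x : ℝ) : ∀ (l : List ℝ), l.Pairwise (· ≤ ·) → ∀ p, p < l.length →
    (l.getD p 0 < x ↔ p < l.countP (fun y => decide (y < x))) := by
  intro l
  induction l with
  | nil => intro _ p hp; simp at hp
  | cons a l ih =>
    intro hl p hp
    rw [List.pairwise_cons] at hl
    obtain ⟨h1, h2⟩ := hl
    by_cases ha : a < x
    · rw [List.countP_cons_of_pos (by simpa using ha)]
      cases p with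
      | zero => simpa using ha
      | succ p =>
        have := ih h2 p (by simpa using hp)
        rw [List.getD_cons_succ, this]; omega
    · rw [List.countP_cons_of_neg (by simpa using ha)]
      have h0 : l.countP (fun y => decide (y < x)) = 0 := by
        rw [List.countP_eq_zero]
        intro y hy
        have := h1 y hy
        simp only [decide_eq_true_eq, not_lt]; linarith [not_lt.1 ha]
      rw [h0]
      cases p with
      | zero => simpa using ha
      | succ p =>
        have hp' : p < l.length := by simpa using hp
        rw [List.getD_cons_succ, List.getD_eq_getElem _ _ hp']
        have := h1 _ (List.getElem_mem hp')
        simp only [Nat.not_lt_zero, iff_false, not_lt]; linarith [not_lt.1 ha]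

lemma aux_rank {N : ℕ} (v : Fin N → ℝ) (hv : Function.Injective v) (i : ℕ) (hi : i ≤ N) :
    (univ.filter fun j0 : Fin N => N - i ≤ (univ.filter fun j => v j < v j0).card).card = i := by
  have hlt : ∀ j0 : Fin N, (univ.filter fun j => v j < v j0).card < N := by
    intro j0
    calc _ < (univ : Finset (Fin N)).card := by
          apply Finset.card_lt_card
          rw [Finset.ssubset_univ_iff]
          intro h
          have := Finset.mem_univ j0
          rw [← h] at this
          simp at this
      _ = N := by simp
  let r : Fin N → Fin N := fun j0 => ⟨_, hlt j0⟩
  have hmono : ∀ a b, v a < v b → r a < r b := by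
    intro a b hab
    show (univ.filter fun j => v j < v a).card < (univ.filter fun j => v j < v b).card
    apply Finset.card_lt_card
    rw [Finset.ssubset_iff_of_subset]
    · exact ⟨a, by simpa using hab, by simp⟩
    · intro j; simp only [mem_filter, mem_univ, true_and]; intro h; exact h.trans hab
  have hr : Function.Injective r := by
    intro a b hab
    by_contra hne
    rcases lt_or_gt_of_ne (fun h => hne (hv h)) with h | h
    · exact (hmono _ _ h).ne hab
    · exact (hmono _ _ h).ne hab.symm
  let e : Fin N ≃ Fin N := Equiv.ofBijective r (Finite.injective_iff_bijective.1 hr)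
  have h1 : (univ.filter fun j0 : Fin N => N - i ≤ (univ.filter fun j => v j < v j0).card).card
      = (univ.filter fun k : Fin N => N - i ≤ k.1).card := by
    apply Finset.card_equiv e
    intro j; simp [e, r, Equiv.ofBijective]
  rw [h1]
  have h2 := Finset.card_filter_add_card_filter_not (s := (univ : Finset (Fin N)))
    (fun k : Fin N => N - i ≤ k.1)
  have h3 : (univ.filter fun k : Fin N => ¬ N - i ≤ k.1).card = N - i := by
    simp only [not_le]
    rw [Fin.card_filter_val_lt]; omega
  rw [h3] at h2
  rw [Finset.card_univ, Fintype.card_fin] at h2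
  omega

lemma aux_cons {n m : ℕ} (p : Fin m → (Fin n → Fin m) → Prop) [∀ b f, Decidable (p b f)] :
    ∑ b : Fin m, (univ.filter fun f : Fin n → Fin m =>
      (Function.Injective f ∧ ∀ j, f j ≠ b) ∧ p b f).card =
    (univ.filter fun F : Fin (n+1) → Fin m => Function.Injective F ∧
      p (F 0) (fun j => F j.succ)).card := by
  rw [← Finset.card_sigma]
  refine Finset.card_bij' (fun x _ => (Fin.cons x.1 x.2 : Fin (n+1) → Fin m))
    (fun F _ => ⟨F 0, fun j => F j.succ⟩) ?_ ?_ ?_ ?_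
  · rintro ⟨b, f⟩ h
    simp only [mem_sigma, mem_univ, mem_filter, true_and] at h ⊢
    refine ⟨?_, by simpa using h.2⟩
    rw [Fin.cons_injective_iff]
    refine ⟨?_, h.1.1⟩
    rintro ⟨j, hj⟩; exact h.1.2 j hj
  · intro F h
    simp only [mem_sigma, mem_univ, mem_filter, true_and] at h ⊢
    refine ⟨⟨fun a b hab => Fin.succ_injective _ (h.1 hab), fun j hj => ?_⟩, h.2⟩
    exact Fin.succ_ne_zero j (h.1 hj)
  · rintro ⟨b, f⟩ _; simp
  · intro F _; exact Fin.cons_self_tail F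

lemma aux_cardsucc {n : ℕ} (u : Fin (n+1) → ℝ) (x : ℝ) (hx : x = u 0) :
    (univ.filter fun j : Fin (n+1) => u j < x).card =
    (univ.filter fun j : Fin n => u j.succ < x).card := by
  subst hx
  rw [Fin.univ_succ, Finset.filter_cons]
  simp [Finset.filter_map]

lemma aux_count {n m : ℕ} (Z : Fin m → ℝ) (hZ : Function.Injective Z) (i : ℕ) (hi : i ≤ n + 1) :
    (n+1) * ∑ b : Fin m, (univ.filter fun f : Fin n → Fin m =>
      (Function.Injective f ∧ ∀ j, f j ≠ b) ∧
        n + 1 - i ≤ (univ.filter fun j => Z (f j) < Z b).card).card =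
    i * ∑ b : Fin m, (univ.filter fun f : Fin n → Fin m =>
      (Function.Injective f ∧ ∀ j, f j ≠ b)).card := by
  have h1 := aux_cons (n := n) (m := m) (fun b f => n + 1 - i ≤ (univ.filter fun j => Z (f j) < Z b).card)
  have h2 := aux_cons (n := n) (m := m) (fun b f => True)
  simp only [and_true] at h2
  rw [h1, h2]
  have h3 : ∀ F : Fin (n+1) → Fin m, (univ.filter fun j : Fin n => Z (F j.succ) < Z (F 0)).card
      = (univ.filter fun j : Fin (n+1) => Z (F j) < Z (F 0)).card := fun F =>
    (aux_cardsucc (fun j => Z (F j)) _ rfl).symm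
  simp only [h3]
  have h4 : ∀ j0 : Fin (n+1), (univ.filter fun F : Fin (n+1) → Fin m => Function.Injective F ∧
      n + 1 - i ≤ (univ.filter fun j => Z (F j) < Z (F j0)).card).card =
      (univ.filter fun F : Fin (n+1) → Fin m => Function.Injective F ∧
      n + 1 - i ≤ (univ.filter fun j => Z (F j) < Z (F 0)).card).card := by
    intro j0
    apply Finset.card_equiv (Equiv.arrowCongr (Equiv.swap 0 j0) (Equiv.refl _))
    intro F
    have hc : (univ.filter fun j => Z (F j) < Z (F j0)).card =
        (univ.filter fun j => Z (F (Equiv.swap 0 j0 j)) < Z (F j0)).card := by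
      apply Finset.card_equiv (Equiv.swap 0 j0)
      intro j; simp
    simp only [mem_filter, mem_univ, true_and, Equiv.arrowCongr_apply, Equiv.coe_refl,
      Function.comp_def, id, Equiv.symm_swap, Equiv.swap_apply_left, hc]
    refine and_congr ?_ Iff.rfl
    exact ((Equiv.swap 0 j0).injective_comp F).symm
  have h5 : (n+1) * (univ.filter fun F : Fin (n+1) → Fin m => Function.Injective F ∧
      n + 1 - i ≤ (univ.filter fun j => Z (F j) < Z (F 0)).card).card =
      ∑ j0 : Fin (n+1), (univ.filter fun F : Fin (n+1) → Fin m => Function.Injective F ∧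
      n + 1 - i ≤ (univ.filter fun j => Z (F j) < Z (F j0)).card).card := by
    rw [Finset.sum_congr rfl (fun j _ => h4 j), Finset.sum_const, Finset.card_univ, Fintype.card_fin,
      smul_eq_mul]
  rw [h5]
  simp only [← Finset.filter_filter]
  simp only [Finset.card_filter _ (univ.filter _)]
  rw [Finset.sum_comm]
  rw [mul_comm, ← smul_eq_mul, ← Finset.sum_const]
  apply Finset.sum_congr rfl
  intro F hF
  rw [← Finset.card_filter]
  exact aux_rank (fun j => Z (F j)) (hZ.comp (by simpa using hF)) i hi

lemma aux_pointwise {G : Type*} [Group G] [Fintype G] {n m : ℕ} (hm : 0 < m) (c : G → Fin m)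
    (hsize : ∀ i j : Fin m,
      (Finset.univ.filter fun g : G => c g = i).card =
        (Finset.univ.filter fun g : G => c g = j).card)
    (hrep : Fin m → G) (hrepmem : ∀ i : Fin m, c (hrep i) = i)
    (hrep1 : hrep ⟨0, hm⟩ = 1)
    (hR : ∀ a b g : G, c (a * g) = c (b * g) ↔ c a = c b)
    (y : G → ℝ) (hy : ∀ a b, y a = y b ↔ c a = c b) (i : ℕ) (hi : i ≤ n + 1) :
    (n + 1) * ∑ g : G, (univ.filter fun f : Fin n → Fin m =>
      (Function.Injective f ∧ ∀ j, f j ≠ ⟨0, hm⟩) ∧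
      n + 1 - i ≤ (univ.filter fun j => y (hrep (f j) * g) < y g).card).card =
    i * (Fintype.card G * (univ.filter fun f : Fin n → Fin m =>
      (Function.Injective f ∧ ∀ j, f j ≠ ⟨0, hm⟩)).card) := by
  set Z : Fin m → ℝ := fun b => y (hrep b) with hZdef
  have hyZ : ∀ a, y a = Z (c a) := fun a => (hy _ _).2 (hrepmem _).symm
  have hZ : Function.Injective Z := by
    intro a b h
    have := (hy _ _).1 h
    rwa [hrepmem, hrepmem] at this
  have hinj : ∀ g, Function.Injective (fun b => c (hrep b * g)) := by
    intro g a b h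
    have := (hR _ _ _).1 h
    rwa [hrepmem, hrepmem] at this
  let π : G → (Fin m ≃ Fin m) := fun g =>
    Equiv.ofBijective (fun b => c (hrep b * g)) (Finite.injective_iff_bijective.1 (hinj g))
  have hπ : ∀ g b, π g b = c (hrep b * g) := fun g b => rfl
  have hπ0 : ∀ g, π g ⟨0, hm⟩ = c g := by intro g; rw [hπ, hrep1, one_mul]
  have hbase : ∀ (g : G) (f : Fin n → Fin m),
      ((Function.Injective f ∧ ∀ j, f j ≠ ⟨0, hm⟩) ↔
      (Function.Injective (fun j => π g (f j)) ∧ ∀ j, π g (f j) ≠ c g)) := by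
    intro g f
    refine and_congr ((π g).injective.of_comp_iff f).symm ?_
    refine forall_congr' fun j => ?_
    rw [← hπ0 g, (π g).injective.ne_iff]
  have hΦ : ∀ g : G, (univ.filter fun f : Fin n → Fin m =>
      (Function.Injective f ∧ ∀ j, f j ≠ ⟨0, hm⟩) ∧
      n + 1 - i ≤ (univ.filter fun j => y (hrep (f j) * g) < y g).card).card =
      (univ.filter fun f : Fin n → Fin m =>
      (Function.Injective f ∧ ∀ j, f j ≠ c g) ∧
        n + 1 - i ≤ (univ.filter fun j => Z (f j) < Z (c g)).card).card := by
    intro g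
    apply Finset.card_equiv (Equiv.arrowCongr (Equiv.refl _) (π g))
    intro f
    simp only [mem_filter, mem_univ, true_and]
    refine and_congr (hbase g f) ?_
    simp only [hyZ, ← hπ]
    rfl
  have hΨ : ∀ g : G, (univ.filter fun f : Fin n → Fin m =>
      (Function.Injective f ∧ ∀ j, f j ≠ ⟨0, hm⟩)).card =
      (univ.filter fun f : Fin n → Fin m =>
      (Function.Injective f ∧ ∀ j, f j ≠ c g)).card := by
    intro g
    apply Finset.card_equiv (Equiv.arrowCongr (Equiv.refl _) (π g))
    intro f
    simp only [mem_filter, mem_univ, true_and]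
    exact hbase g f
  have hfib : ∀ φ : Fin m → ℕ, ∑ g : G, φ (c g) =
      (univ.filter fun g : G => c g = ⟨0, hm⟩).card * ∑ b, φ b := by
    intro φ
    rw [← Finset.sum_fiberwise univ c, Finset.mul_sum]
    apply Finset.sum_congr rfl
    intro b _
    rw [hsize _ b, ← smul_eq_mul, ← Finset.sum_const]
    apply Finset.sum_congr rfl
    intro g hg
    simp at hg; rw [hg]
  have hG : Fintype.card G * (univ.filter fun f : Fin n → Fin m =>
      (Function.Injective f ∧ ∀ j, f j ≠ ⟨0, hm⟩)).card =
      ∑ g : G, (univ.filter fun f : Fin n → Fin m =>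
      (Function.Injective f ∧ ∀ j, f j ≠ c g)).card := by
    rw [← Finset.sum_congr rfl (fun g _ => hΨ g)]; simp
  rw [hG, Finset.sum_congr rfl (fun g _ => hΦ g)]
  rw [hfib (fun b => (univ.filter fun f : Fin n → Fin m =>
      (Function.Injective f ∧ ∀ j, f j ≠ b) ∧
        n + 1 - i ≤ (univ.filter fun j => Z (f j) < Z b).card).card),
    hfib (fun b => (univ.filter fun f : Fin n → Fin m =>
      (Function.Injective f ∧ ∀ j, f j ≠ b)).card)]
  have := aux_count (n := n) Z hZ i hi
  rw [mul_left_comm, this, mul_left_comm]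

lemma aux_core
    {Ω 𝒳 G : Type*} [MeasurableSpace Ω] [MeasurableSpace 𝒳]
    [Group G] [Fintype G] [MulAction G 𝒳]
    (P : Measure Ω) [IsProbabilityMeasure P]
    (X : Ω → 𝒳) (hX : Measurable X)
    (hG : ∀ g : G, Measurable fun x : 𝒳 => g • x)
    (T : 𝒳 → ℝ) (hT : Measurable T)
    (hinv : ∀ g : G,
      Measure.map (fun ω => fun a : G => T (a • X ω)) P =
        Measure.map (fun ω => fun a : G => T (a • g • X ω)) P)
    (m : ℕ) (hm : 0 < m) (c : G → Fin m)
    (hsize : ∀ i j : Fin m,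
      (Finset.univ.filter fun g : G => c g = i).card =
        (Finset.univ.filter fun g : G => c g = j).card)
    (hcond : ∀ᵐ ω ∂P, ∀ g g' : G, T (g • X ω) = T (g' • X ω) ↔ c g = c g')
    (hrep : Fin m → G) (hrepmem : ∀ i : Fin m, c (hrep i) = i)
    (hrep1 : hrep ⟨0, hm⟩ = 1)
    (n : ℕ)
    (σ : Ω → Fin n → Fin m) (hσ : Measurable fun ω => σ ω)
    (s : Finset (Fin n → Fin m))
    (hs : s = Finset.univ.filter
      (fun f : Fin n → Fin m => Function.Injective f ∧ ∀ j, f j ≠ ⟨0, hm⟩))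
    (hsne : s.Nonempty)
    (hlaw : Measure.map (fun ω => (X ω, σ ω)) P =
      (Measure.map X P).prod ((PMF.uniformOfFinset s hsne).toMeasure))
    (i : ℕ) (hi : i ≤ n + 1) :
    (P {ω | n + 1 - i ≤
      (univ.filter fun j : Fin n => T (hrep (σ ω j) • X ω) < T (X ω)).card}).toReal =
      (i : ℝ) / ((n + 1 : ℕ) : ℝ) := by
  classical
  have hYm : ∀ g : G, Measurable (fun ω => fun a : G => T (a • g • X ω)) := fun g =>
    measurable_pi_lambda _ fun a => hT.comp ((hG a).comp ((hG g).comp hX))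
  have hYm1 : Measurable (fun ω => fun a : G => T (a • X ω)) :=
    measurable_pi_lambda _ fun a => hT.comp ((hG a).comp hX)
  -- right multiplication respects blocks
  have hR : ∀ a b g : G, c (a * g) = c (b * g) ↔ c a = c b := by
    intro a b g
    have hB : MeasurableSet {y : G → ℝ | y a = y b ↔ c a = c b} := by
      have h0 : MeasurableSet {y : G → ℝ | y a = y b} :=
        measurableSet_eq_fun (measurable_pi_apply a) (measurable_pi_apply b)
      by_cases h : c a = c b
      · simpa [h] using h0
      · have h1 := h0.compl
        have h2 : {y : G → ℝ | y a = y b ↔ c a = c b} = {y : G → ℝ | y a = y b}ᶜ := by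
          ext y; simp [h]
        rw [h2]; exact h1
    have h1 : ∀ᵐ y ∂(Measure.map (fun ω => fun a : G => T (a • X ω)) P),
        (y a = y b ↔ c a = c b) := by
      rw [ae_map_iff hYm1.aemeasurable hB]
      filter_upwards [hcond] with ω hω using hω a b
    rw [hinv g, ae_map_iff (hYm g).aemeasurable hB] at h1
    obtain ⟨ω, h2, h3⟩ := (h1.and hcond).exists
    rw [← h2, ← h3]
    simp only [mul_smul]
  have hmeasD : ∀ f : Fin n → Fin m, MeasurableSet {y : G → ℝ | n + 1 - i ≤
      (univ.filter fun j : Fin n => y (hrep (f j)) < y 1).card} := by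
    intro f
    simp only [Finset.card_filter]
    refine measurableSet_le measurable_const (Finset.measurable_sum _ fun j _ => ?_)
    exact Measurable.ite (measurableSet_lt (measurable_pi_apply _) (measurable_pi_apply _))
      measurable_const measurable_const
  set q : (Fin n → Fin m) → ENNReal := fun f => P {ω | n + 1 - i ≤
      (univ.filter fun j : Fin n => T (hrep (f j) • X ω) < T (X ω)).card} with hq
  have hqg : ∀ (f : Fin n → Fin m) (g : G), q f = P {ω | n + 1 - i ≤
      (univ.filter fun j : Fin n => T ((hrep (f j) * g) • X ω) < T (g • X ω)).card} := by
    intro f g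
    have h1 := congrArg (fun μ => μ {y : G → ℝ | n + 1 - i ≤
      (univ.filter fun j : Fin n => y (hrep (f j)) < y 1).card}) (hinv g)
    beta_reduce at h1
    rw [Measure.map_apply hYm1 (hmeasD f), Measure.map_apply (hYm g) (hmeasD f)] at h1
    simpa [hq, Set.preimage, mul_smul] using h1
  have hmq : ∀ (f : Fin n → Fin m) (g : G), MeasurableSet {ω | n + 1 - i ≤
      (univ.filter fun j : Fin n => T ((hrep (f j) * g) • X ω) < T (g • X ω)).card} := by
    intro f g
    have := (hYm g) (hmeasD f)
    simpa [Set.preimage, mul_smul] using this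
  have hmx : ∀ f : Fin n → Fin m, MeasurableSet {x : 𝒳 | n + 1 - i ≤
      (univ.filter fun j : Fin n => T (hrep (f j) • x) < T x).card} := by
    intro f
    have h : Measurable (fun x : 𝒳 => fun a : G => T (a • x)) :=
      measurable_pi_lambda _ fun a => hT.comp (hG a)
    simpa [Set.preimage] using h (hmeasD f)
  -- the averaged identity
  have hsum : ((n + 1 : ℕ) : ENNReal) * ((Fintype.card G : ENNReal) * ∑ f ∈ s, q f) =
      (i : ENNReal) * ((Fintype.card G : ENNReal) * (s.card : ENNReal)) := by
    have e1 : (Fintype.card G : ENNReal) * ∑ f ∈ s, q f = ∫⁻ ω, ((∑ g : G,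
        (univ.filter fun f : Fin n → Fin m =>
        (Function.Injective f ∧ ∀ j, f j ≠ ⟨0, hm⟩) ∧
        n + 1 - i ≤ (univ.filter fun j => T ((hrep (f j) * g) • X ω) < T (g • X ω)).card).card : ℕ) :
          ENNReal) ∂P := by
      have e2 : ∀ ω, ((∑ g : G,
        (univ.filter fun f : Fin n → Fin m =>
        (Function.Injective f ∧ ∀ j, f j ≠ ⟨0, hm⟩) ∧
        n + 1 - i ≤ (univ.filter fun j => T ((hrep (f j) * g) • X ω) < T (g • X ω)).card).card : ℕ) :
          ENNReal) = ∑ g : G, ∑ f ∈ s, Set.indicator {ω | n + 1 - i ≤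
      (univ.filter fun j : Fin n => T ((hrep (f j) * g) • X ω) < T (g • X ω)).card} 1 ω := by
        intro ω
        rw [Nat.cast_sum]
        refine Finset.sum_congr rfl fun g _ => ?_
        rw [← Finset.filter_filter, ← hs, Finset.card_filter, Nat.cast_sum]
        refine Finset.sum_congr rfl fun f _ => ?_
        rw [Set.indicator_apply]
        simp only [Set.mem_ofPred_eq, Pi.one_apply, Nat.cast_ite, Nat.cast_one, Nat.cast_zero]
      rw [lintegral_congr e2, lintegral_finsetSum]
      · rw [← nsmul_eq_mul, ← Finset.card_univ, ← Finset.sum_const]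
        refine Finset.sum_congr rfl fun g _ => ?_
        rw [lintegral_finsetSum]
        · refine Finset.sum_congr rfl fun f _ => ?_
          rw [lintegral_indicator_one (hmq f g), hqg f g]
        · intro f _; exact measurable_one.indicator (hmq f g)
      · intro g _
        exact Finset.measurable_sum _ fun f _ => measurable_one.indicator (hmq f g)
    rw [e1, ← lintegral_const_mul' _ _ (ENNReal.natCast_ne_top _)]
    have e3 : ∀ᵐ ω ∂P, ((n + 1 : ℕ) : ENNReal) * ((∑ g : G,
        (univ.filter fun f : Fin n → Fin m =>
        (Function.Injective f ∧ ∀ j, f j ≠ ⟨0, hm⟩) ∧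
        n + 1 - i ≤ (univ.filter fun j => T ((hrep (f j) * g) • X ω) < T (g • X ω)).card).card : ℕ) :
          ENNReal) = (i : ENNReal) * ((Fintype.card G : ENNReal) * (s.card : ENNReal)) := by
      filter_upwards [hcond] with ω hω
      have := aux_pointwise hm c hsize hrep hrepmem hrep1 hR (fun a => T (a • X ω)) hω i hi
      rw [← hs] at this
      exact_mod_cast this
    rw [lintegral_congr_ae e3]
    simp
  have hE : MeasurableSet {z : 𝒳 × (Fin n → Fin m) | n + 1 - i ≤
      (univ.filter fun j : Fin n => T (hrep (z.2 j) • z.1) < T z.1).card} := by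
    have : {z : 𝒳 × (Fin n → Fin m) | n + 1 - i ≤
      (univ.filter fun j : Fin n => T (hrep (z.2 j) • z.1) < T z.1).card} =
      ⋃ f : Fin n → Fin m, {x : 𝒳 | n + 1 - i ≤
      (univ.filter fun j : Fin n => T (hrep (f j) • x) < T x).card} ×ˢ {f} := by
      ext ⟨x, f⟩
      simp
    rw [this]
    exact MeasurableSet.iUnion fun f => (hmx f).prod (measurableSet_singleton f)
  have hPE : P {ω | n + 1 - i ≤
      (univ.filter fun j : Fin n => T (hrep (σ ω j) • X ω) < T (X ω)).card} =
      (∑ f ∈ s, q f) * (s.card : ENNReal)⁻¹ := by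
    have h1 := congrArg (fun μ => μ {z : 𝒳 × (Fin n → Fin m) | n + 1 - i ≤
      (univ.filter fun j : Fin n => T (hrep (z.2 j) • z.1) < T z.1).card}) hlaw
    beta_reduce at h1
    have : IsProbabilityMeasure (Measure.map X P) := Measure.isProbabilityMeasure_map hX.aemeasurable
    rw [Measure.map_apply (hX.prodMk hσ) hE, Measure.prod_apply_symm hE, lintegral_fintype] at h1
    refine h1.trans ?_
    rw [Finset.sum_mul, ← Finset.sum_subset (Finset.subset_univ s)]
    · refine Finset.sum_congr rfl fun f hf => ?_
      rw [PMF.toMeasure_apply_singleton _ _ (measurableSet_singleton f),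
        PMF.uniformOfFinset_apply_of_mem _ hf]
      congr 1
      exact Measure.map_apply hX (hmx f)
    · intro f _ hf
      rw [PMF.toMeasure_apply_singleton _ _ (measurableSet_singleton f),
        PMF.uniformOfFinset_apply_of_notMem _ hf, mul_zero]
  rw [hPE]
  have hsum' := congrArg ENNReal.toReal hsum
  simp only [ENNReal.toReal_mul, ENNReal.toReal_natCast, ENNReal.toReal_inv] at hsum' ⊢
  have hc0 : (Fintype.card G : ℝ) ≠ 0 := by exact_mod_cast Fintype.card_ne_zero
  have hs0 : (s.card : ℝ) ≠ 0 := by exact_mod_cast hsne.card_pos.ne'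
  have hn0 : ((n + 1 : ℕ) : ℝ) ≠ 0 := by exact_mod_cast Nat.succ_ne_zero n
  rw [← div_eq_mul_inv, div_eq_div_iff hs0 hn0]
  apply mul_left_cancel₀ hc0
  linarith

/-- exactness of the random-permutation test under the partition
condition: with representatives `h₁ = id ∈ G₁, …, h_m ∈ G_m`, `g₁ = id` and
`g₂, …, g_w` drawn uniformly without replacement from `{h₂, …, h_m}` independently
of `X`, the test has rejection probability exactly `α` for every
`α ∈ {0/w, 1/w, …, (w−1)/w}`. -/
theorem random_permutation_test_exact_partition
    {Ω 𝒳 G : Type*} [MeasurableSpace Ω] [MeasurableSpace 𝒳]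
    [Group G] [Fintype G] [MulAction G 𝒳]
    (P : Measure Ω) [IsProbabilityMeasure P]
    (X : Ω → 𝒳) (hX : Measurable X)
    (hG : ∀ g : G, Measurable fun x : 𝒳 => g • x)
    (T : 𝒳 → ℝ) (hT : Measurable T)
    (hinv : ∀ g : G,
      Measure.map (fun ω => fun a : G => T (a • X ω)) P =
        Measure.map (fun ω => fun a : G => T (a • g • X ω)) P)
    -- the partition: `c g` is the index of the block containing `g`
    (m : ℕ) (hm : 0 < m) (c : G → Fin m)
    (hc1 : c 1 = ⟨0, hm⟩)
    (hsize : ∀ i j : Fin m,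
      (Finset.univ.filter fun g : G => c g = i).card =
        (Finset.univ.filter fun g : G => c g = j).card)
    (hcond : ∀ᵐ ω ∂P, ∀ g g' : G, T (g • X ω) = T (g' • X ω) ↔ c g = c g')
    -- representatives `h i ∈ G_i`, with `h₁ = id`
    (hrep : Fin m → G) (hrepmem : ∀ i : Fin m, c (hrep i) = i)
    (hrep1 : hrep ⟨0, hm⟩ = 1)
    (w : ℕ) (hw : 0 < w) (hwm : w ≤ m)
    -- random block indices: injective, avoiding block 1, uniform, independent of `X`
    (σ : Ω → Fin (w - 1) → Fin m) (hσ : Measurable fun ω => σ ω)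
    (s : Finset (Fin (w - 1) → Fin m))
    (hs : s = Finset.univ.filter
      (fun f : Fin (w - 1) → Fin m => Function.Injective f ∧ ∀ j, f j ≠ ⟨0, hm⟩))
    (hsne : s.Nonempty)
    (hlaw : Measure.map (fun ω => (X ω, σ ω)) P =
      (Measure.map X P).prod ((PMF.uniformOfFinset s hsne).toMeasure))
    -- the transformations used: `g₁ = id`, `g_{j+1} = h_{σ_j}`
    (G' : Ω → Fin w → G)
    (hG'def : ∀ ω, ∀ j : Fin w,
      G' ω j = if hj : j.1 = 0 then 1 else hrep (σ ω ⟨j.1 - 1, by omega⟩))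
    (α : ℝ) (i : ℕ) (hi : i < w) (hαi : α = (i : ℝ) / w) :
    (P {ω | T (X ω) >
        sortedVal (Multiset.map (fun j : Fin w => T (G' ω j • X ω)) Finset.univ.val)
          (Nat.ceil ((1 - α) * (w : ℝ)))}).toReal = α := by
  obtain ⟨n, rfl⟩ : ∃ n, w = n + 1 := ⟨w - 1, by omega⟩
  have key := aux_core P X hX hG T hT hinv m hm c hsize hcond hrep hrepmem hrep1 n σ hσ s hs hsne
    hlaw i hi.le
  rw [hαi]
  refine Eq.trans ?_ key
  congr 2
  ext ω
  have hceil : Nat.ceil ((1 - (i : ℝ) / ((n + 1 : ℕ) : ℝ)) * ((n + 1 : ℕ) : ℝ)) = n + 1 - i := by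
    have hn0 : ((n + 1 : ℕ) : ℝ) ≠ 0 := by exact_mod_cast Nat.succ_ne_zero n
    have : (1 - (i : ℝ) / ((n + 1 : ℕ) : ℝ)) * ((n + 1 : ℕ) : ℝ) = ((n + 1 - i : ℕ) : ℝ) := by
      rw [Nat.cast_sub hi.le]; field_simp
    rw [this, Nat.ceil_natCast]
  simp only [Set.mem_ofPred_eq, gt_iff_lt]
  rw [hceil, sortedVal]
  set M := Multiset.map (fun j : Fin (n + 1) => T (G' ω j • X ω)) Finset.univ.val with hM
  have hlen : (M.sort (· ≤ ·)).length = n + 1 := by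
    rw [Multiset.length_sort, hM, Multiset.card_map]; simp
  rw [aux_sorted (T (X ω)) _ (Multiset.pairwise_sort M (· ≤ ·)) _ (by rw [hlen]; omega)]
  have hcount : (M.sort (· ≤ ·)).countP (fun y => decide (y < T (X ω))) =
      (univ.filter fun j : Fin n => T (hrep (σ ω j) • X ω) < T (X ω)).card := by
    have h1 : (M.sort (· ≤ ·)).countP (fun y => decide (y < T (X ω))) =
        M.countP (fun y => y < T (X ω)) := by
      conv_rhs => rw [← Multiset.sort_eq M (· ≤ ·)]
      rw [Multiset.coe_countP]
    rw [h1, hM, Multiset.countP_map]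
    have h2 := aux_cardsucc (fun j : Fin (n + 1) => T (G' ω j • X ω)) (T (X ω))
      (by simp [hG'def])
    have h3 : ∀ j : Fin n, G' ω j.succ = hrep (σ ω j) := by
      intro j
      rw [hG'def, dif_neg (by simp)]
      rfl
    simp only [h3] at h2
    exact h2
  rw [hcount]
  omega
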